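/- Let u, v, w be integers with 1 ≤ u < v < w and let x, y, z be positive integers with 1 + uv = T_x, 1 + uw = T_y and 1 + vw = T_z. If z ≥ 12, then x ≥ z/4 − 2; in particular x ≥ z/12. -/

import Mathlib

/-- The Tribonacci sequence. -/
def T : ℕ → ℕ
  | 0 => 0
  | 1 => 0
  | 2 => 1
  | (n + 3) => T (n + 2) + T (n + 1) + T n

theorem T_rec (n : ℕ) : T (n + 3) = T (n + 2) + T (n + 1) + T n := by rw [T]

theorem T_mono_succ (n : ℕ) : T n ≤ T (n + 1) := by
  rcases n with _ | _ | n
  · simp [T]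
  · simp [T]
  · have := T_rec n
    show T (n + 2) ≤ T (n + 3)
    omega

theorem exists_alpha : ∃ a : ℝ, 1.8 ≤ a ∧ a ≤ 1.85 ∧ a ^ 3 = a ^ 2 + a + 1 := by
  have hc : ContinuousOn (fun x : ℝ => x ^ 3 - x ^ 2 - x - 1) (Set.Icc 1.8 1.85) := by fun_prop
  have := intermediate_value_Icc (by norm_num) hc
  have h0 : (0 : ℝ) ∈ Set.Icc ((1.8 : ℝ) ^ 3 - 1.8 ^ 2 - 1.8 - 1)
      ((1.85 : ℝ) ^ 3 - 1.85 ^ 2 - 1.85 - 1) := by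
    constructor <;> norm_num
  obtain ⟨a, ha, h⟩ := this h0
  refine ⟨a, ha.1, ha.2, ?_⟩
  simp only at h
  linarith

theorem T_upper (a : ℝ) (h1 : 1.8 ≤ a) (h3 : a ^ 3 = a ^ 2 + a + 1) (n : ℕ) :
    a ^ 2 * (T n : ℝ) ≤ a ^ n ∧ a ^ 2 * (T (n + 1) : ℝ) ≤ a ^ (n + 1) ∧
    a ^ 2 * (T (n + 2) : ℝ) ≤ a ^ (n + 2) := by
  induction n with
  | zero => simp [T]; linarith
  | succ n ih =>
    obtain ⟨i1, i2, i3⟩ := ih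
    refine ⟨i2, i3, ?_⟩
    have e : a ^ (n + 3) = a ^ (n + 2) + a ^ (n + 1) + a ^ n := by
      have : a ^ (n + 3) = a ^ n * a ^ 3 := by ring
      rw [this, h3]; ring
    show a ^ 2 * (T (n + 3) : ℝ) ≤ a ^ (n + 3)
    rw [e, T_rec]; push_cast; linarith

theorem T_lower (a : ℝ) (h1 : 1.8 ≤ a) (h2 : a ≤ 1.85) (h3 : a ^ 3 = a ^ 2 + a + 1) (n : ℕ) :
    a ^ (n + 2) ≤ a ^ 3 * (T (n + 2) : ℝ) ∧ a ^ (n + 3) ≤ a ^ 3 * (T (n + 3) : ℝ) ∧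
    a ^ (n + 4) ≤ a ^ 3 * (T (n + 4) : ℝ) := by
  induction n with
  | zero =>
    simp [T]
    refine ⟨by nlinarith, ?_⟩
    have : a ^ 4 = a ^ 3 * a := by ring
    rw [this]
    have : 0 < a ^ 3 := by positivity
    nlinarith
  | succ n ih =>
    obtain ⟨i1, i2, i3⟩ := ih
    refine ⟨i2, i3, ?_⟩
    have e : a ^ (n + 5) = a ^ (n + 4) + a ^ (n + 3) + a ^ (n + 2) := by
      have : a ^ (n + 5) = a ^ (n + 2) * a ^ 3 := by ring
      rw [this, h3]; ring
    show a ^ (n + 5) ≤ a ^ 3 * (T (n + 5) : ℝ)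
    rw [e, T_rec (n + 2)]; push_cast; linarith

/-- bound for binary recurrences -/
theorem rec_bound (a : ℝ) (h1 : 1.8 ≤ a) (h2 : a ≤ 1.85) (h3 : a ^ 3 = a ^ 2 + a + 1)
    (f : ℕ → ℝ) (hf : ∀ n, f (n + 2) = (1 - a) * f (n + 1) - (a ^ 2 - a - 1) * f n) (n : ℕ) :
    ((a ^ 2 - a - 1) - (a - 1) ^ 2 / 4) * f n ^ 2 ≤
      |f 1 ^ 2 + (a - 1) * f 1 * f 0 + (a ^ 2 - a - 1) * f 0 ^ 2| := by
  have q0 : 0 ≤ a ^ 2 - a - 1 := by nlinarith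
  have q1 : a ^ 2 - a - 1 ≤ 1 := by nlinarith
  have key : ∀ n, f (n + 1) ^ 2 + (a - 1) * f (n + 1) * f n + (a ^ 2 - a - 1) * f n ^ 2 =
      (a ^ 2 - a - 1) ^ n * (f 1 ^ 2 + (a - 1) * f 1 * f 0 + (a ^ 2 - a - 1) * f 0 ^ 2) := by
    intro n
    induction n with
    | zero => simp
    | succ n ih =>
      rw [pow_succ (a ^ 2 - a - 1) n, hf]; linear_combination (a ^ 2 - a - 1) * ih
  have k := key n
  have : (a ^ 2 - a - 1) ^ n * (f 1 ^ 2 + (a - 1) * f 1 * f 0 + (a ^ 2 - a - 1) * f 0 ^ 2) ≤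
      1 * |f 1 ^ 2 + (a - 1) * f 1 * f 0 + (a ^ 2 - a - 1) * f 0 ^ 2| := by
    refine (mul_le_mul_of_nonneg_left (le_abs_self _) (pow_nonneg q0 n)).trans ?_
    exact mul_le_mul_of_nonneg_right (pow_le_one₀ q0 q1) (abs_nonneg _)
  nlinarith [sq_nonneg (f (n + 1) + (a - 1) / 2 * f n)]

def pp (a : ℝ) : ℕ → ℝ
  | 0 => 2
  | 1 => 1 - a
  | (n + 2) => (1 - a) * pp a (n + 1) - (a ^ 2 - a - 1) * pp a n

theorem pp_bound (a : ℝ) (h1 : 1.8 ≤ a) (h2 : a ≤ 1.85) (h3 : a ^ 3 = a ^ 2 + a + 1) (n : ℕ) :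
    |pp a n| ≤ 2 := by
  have h := rec_bound a h1 h2 h3 (pp a) (fun n => by rw [pp]) n
  have e : (pp a 1) ^ 2 + (a - 1) * pp a 1 * pp a 0 + (a ^ 2 - a - 1) * pp a 0 ^ 2
     = 4 * ((a ^ 2 - a - 1) - (a - 1) ^ 2 / 4) := by simp only [pp]; ring
  have pos : 0 < (a ^ 2 - a - 1) - (a - 1) ^ 2 / 4 := by nlinarith
  rw [e, abs_of_pos (by linarith), mul_comm 4] at h
  have := le_of_mul_le_mul_left h pos
  refine abs_le_of_sq_le_sq ?_ (by norm_num)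
  linarith

theorem E_bound (a : ℝ) (h1 : 1.8 ≤ a) (h2 : a ≤ 1.85) (h3 : a ^ 3 = a ^ 2 + a + 1) (n : ℕ) :
    |(T (n + 1) : ℝ) - a * T n| ≤ 2 := by
  have h := rec_bound a h1 h2 h3 (fun n => (T (n + 1) : ℝ) - a * T n) (fun n => by
    rw [show n + 2 + 1 = n + 3 from rfl, T_rec]; push_cast
    rw [show n + 1 + 1 = n + 2 from rfl]
    linear_combination (-(T n : ℝ)) * h3) n
  simp [T] at h
  have pos : 0.25 < (a ^ 2 - a - 1) - (a - 1) ^ 2 / 4 := by nlinarith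
  refine abs_le_of_sq_le_sq ?_ (by norm_num)
  nlinarith [sq_nonneg ((T (n + 1) : ℝ) - a * T n)]

theorem D_bound (a : ℝ) (h1 : 1.8 ≤ a) (h2 : a ≤ 1.85) (h3 : a ^ 3 = a ^ 2 + a + 1) (n l : ℕ) :
    |(T (n + l) : ℝ) - a ^ l * T n| ≤ 3 * (a ^ l - 1) := by
  induction l with
  | zero => simp
  | succ l ih =>
    have e := E_bound a h1 h2 h3 (n + l)
    have : (T (n + (l + 1)) : ℝ) - a ^ (l + 1) * T n =
      ((T (n + l + 1) : ℝ) - a * T (n + l)) + a * ((T (n + l) : ℝ) - a ^ l * T n) := by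
      rw [← add_assoc]; ring
    rw [this]
    refine (abs_add_le _ _).trans ?_
    rw [abs_mul, abs_of_pos (by linarith : 0 < a)]
    have := mul_le_mul_of_nonneg_left ih (by linarith : 0 ≤ a)
    rw [pow_succ]
    linarith

theorem t_int (a : ℝ) (h3 : a ^ 3 = a ^ 2 + a + 1) (n : ℕ) :
    (∃ t : ℤ, a ^ n + pp a n = t) ∧ (∃ t : ℤ, a ^ (n + 1) + pp a (n + 1) = t) ∧
    (∃ t : ℤ, a ^ (n + 2) + pp a (n + 2) = t) := by
  induction n with
  | zero =>
    refine ⟨⟨3, by simp [pp]; norm_num⟩, ⟨1, by simp [pp]⟩, ⟨3, by simp [pp]; ring⟩⟩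
  | succ n ih =>
    obtain ⟨⟨t0, i0⟩, ⟨t1, i1⟩, ⟨t2, i2⟩⟩ := ih
    refine ⟨⟨t1, i1⟩, ⟨t2, i2⟩, ⟨t0 + t1 + t2, ?_⟩⟩
    push_cast
    rw [← i0, ← i1, ← i2]
    simp only [show n + 1 + 2 = n + 3 from rfl, pp]
    ring_nf
    linear_combination (a ^ n + pp a n) * h3

theorem s_int (a : ℝ) (h3 : a ^ 3 = a ^ 2 + a + 1) (n : ℕ) :
    (∃ t : ℤ, a ^ n * pp a n + (a ^ 2 - a - 1) ^ n = t) ∧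
    (∃ t : ℤ, a ^ (n + 1) * pp a (n + 1) + (a ^ 2 - a - 1) ^ (n + 1) = t) ∧
    (∃ t : ℤ, a ^ (n + 2) * pp a (n + 2) + (a ^ 2 - a - 1) ^ (n + 2) = t) := by
  induction n with
  | zero =>
    refine ⟨⟨3, by simp [pp]; norm_num⟩, ⟨-1, by simp [pp]; ring⟩, ⟨-1, ?_⟩⟩
    simp [pp]
    linear_combination (-2 : ℝ) * h3
  | succ n ih =>
    obtain ⟨⟨t0, i0⟩, ⟨t1, i1⟩, ⟨t2, i2⟩⟩ := ih
    refine ⟨⟨t1, i1⟩, ⟨t2, i2⟩, ⟨t0 - t1 - t2, ?_⟩⟩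
    push_cast
    rw [← i0, ← i1, ← i2]
    have e1 : pp a (n + 1 + 2) = (1 - a) * pp a (n + 2) - (a ^ 2 - a - 1) * pp a (n + 1) := by
      rw [pp]
    have e2 : pp a (n + 2) = (1 - a) * pp a (n + 1) - (a ^ 2 - a - 1) * pp a n := by
      rw [pp]
    rw [e1, e2]
    generalize pp a (n + 1) = X
    generalize pp a n = Y
    have haq : a * (a ^ 2 - a - 1) = 1 := by linear_combination h3
    have hq : (a ^ 2 - a - 1) ^ 3 = 1 - (a ^ 2 - a - 1) - (a ^ 2 - a - 1) ^ 2 := by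
      have : (a ^ 2 - a - 1) ^ 3 * a ^ 3 =
          (1 - (a ^ 2 - a - 1) - (a ^ 2 - a - 1) ^ 2) * a ^ 3 := by
        generalize a ^ 2 - a - 1 = q at *
        linear_combination (a ^ 2 * q ^ 2 + a * q + 1 + a ^ 2 + a * (a * q + 1)) * haq - h3
      have ha : a ≠ 0 := by rintro rfl; norm_num at h3
      exact mul_right_cancel₀ (pow_ne_zero 3 ha) this
    have e3 : (a ^ 2 - a - 1) ^ (n + 1 + 2) = (a ^ 2 - a - 1) ^ n *
       (1 - (a ^ 2 - a - 1) - (a ^ 2 - a - 1) ^ 2) := by rw [← hq]; ring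
    rw [e3]
    have m : a ^ (n + 1 + 2) * ((1 - a) * ((1 - a) * X - (a ^ 2 - a - 1) * Y) -
        (a ^ 2 - a - 1) * X) = a ^ n * Y - a ^ (n + 1) * X -
        a ^ (n + 2) * ((1 - a) * X - (a ^ 2 - a - 1) * Y) := by
      have : a ^ 3 * ((1 - a) * ((1 - a) * X - (a ^ 2 - a - 1) * Y) -
        (a ^ 2 - a - 1) * X) = Y - a * X -
        a ^ 2 * ((1 - a) * X - (a ^ 2 - a - 1) * Y) := by
        linear_combination Y * ((-a ^ 2 * (1 - a) - a) * haq + h3) +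
          X * (-a ^ 2 * haq + a * (a - 1) * h3)
      have e := congrArg (fun r => a ^ n * r) this
      linear_combination e
    linear_combination m

theorem P_ne (u v t s : ℤ) (hu : 1 ≤ u) (huv : u < v) :
    v ^ 3 - t * v ^ 2 * u + s * v * u ^ 2 - u ^ 3 ≠ 0 := by
  intro h
  obtain ⟨g, u', v', hg, hc, rfl, rfl⟩ : ∃ g u' v' : ℤ, 0 < g ∧ IsCoprime u' v' ∧
      u = u' * g ∧ v = v' * g := by
    have hg : 0 < Int.gcd u v := Int.gcd_pos_of_ne_zero_left _ (by omega)
    obtain ⟨u', v', hc, e1, e2⟩ := Int.exists_gcd_one hg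
    exact ⟨Int.gcd u v, u', v', by exact_mod_cast hg, Int.isCoprime_iff_gcd_eq_one.mpr hc, e1, e2⟩
  have hu' : 0 < u' := by
    by_contra hh
    nlinarith
  have hlt : u' < v' := lt_of_mul_lt_mul_right huv hg.le
  have h' : g ^ 3 * (v' ^ 3 - t * v' ^ 2 * u' + s * v' * u' ^ 2 - u' ^ 3) = 0 := by
    rw [← h]; ring
  have h2 := (mul_eq_zero.mp h').resolve_left (by positivity)
  have hd : v' ∣ u' ^ 3 := ⟨v' ^ 2 - t * v' * u' + s * u' ^ 2, by linarith⟩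
  have hun : IsUnit v' := (hc.symm.pow_right (n := 3)).isUnit_of_dvd' dvd_rfl hd
  rcases Int.isUnit_iff.mp hun with h | h <;> omega

set_option maxHeartbeats 1000000 in
theorem tribonacci_triple_lower_bound (u v w : ℤ) (hu : 1 ≤ u) (huv : u < v)
    (hvw : v < w) (x y z : ℕ) (hx : 0 < x) (hy : 0 < y) (hz : 0 < z)
    (h1 : 1 + u * v = (T x : ℤ)) (h2 : 1 + u * w = (T y : ℤ))
    (h3 : 1 + v * w = (T z : ℤ)) (hz12 : 12 ≤ z) :
    (z : ℚ) / 4 - 2 ≤ (x : ℚ) ∧ (z : ℚ) / 12 ≤ (x : ℚ) := by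
  suffices hmain : z ≤ 4 * x + 8 by
    have c1 : (z : ℚ) ≤ 4 * x + 8 := by exact_mod_cast hmain
    have c2 : (12 : ℚ) ≤ z := by exact_mod_cast hz12
    constructor <;> linarith
  obtain ⟨a, a1, a2, a3⟩ := exists_alpha
  have ap : 0 < a := by linarith
  have qq0 : 0 ≤ a ^ 2 - a - 1 := by nlinarith
  have qq1 : a ^ 2 - a - 1 ≤ 1 := by nlinarith
  have hmono : Monotone T := monotone_nat_of_le_succ T_mono_succ
  have hyz : y < z := by
    by_contra hh
    have : T z ≤ T y := hmono (by omega)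
    have : (T z : ℤ) ≤ T y := by exact_mod_cast this
    nlinarith
  obtain ⟨l, rfl⟩ := Nat.exists_eq_add_of_lt hyz
  rw [add_assoc] at hyz hz hz12 h3 ⊢
  generalize hL : l + 1 = L at *
  have r1 : 1 + (u : ℝ) * v = T x := by exact_mod_cast h1
  have r2 : 1 + (u : ℝ) * w = T y := by exact_mod_cast h2
  have r3 : 1 + (v : ℝ) * w = T (y + L) := by exact_mod_cast h3
  have ru : (1 : ℝ) ≤ u := by exact_mod_cast hu
  have ruv : (u : ℝ) + 1 ≤ v := by exact_mod_cast huv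
  have rvw : (v : ℝ) + 1 ≤ w := by exact_mod_cast hvw
  have rv0 : (0 : ℝ) ≤ v := by linarith
  have up := (T_upper a a1 a3 x).1
  have upy := (T_upper a a1 a3 y).1
  have lo : a ^ (y + L) ≤ a ^ 3 * (T (y + L) : ℝ) := by
    have := (T_lower a a1 a2 a3 (y + L - 2)).1
    rwa [show y + L - 2 + 2 = y + L by omega] at this
  -- a^z ≤ a^4 v w
  have lo' : a ^ (y + L) ≤ a ^ 4 * (v * w : ℝ) := by
    have : (T (y + L) : ℝ) ≤ a * (v * w) := by
      rw [← r3]; nlinarith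
    calc _ ≤ _ := lo
      _ ≤ a ^ 3 * (a * (v * w)) := by gcongr
      _ = _ := by ring
  have hv : a ^ 2 * (v : ℝ) ≤ a ^ x := by
    refine le_trans ?_ up
    gcongr
    nlinarith
  have hv4 : a ^ 8 * (v : ℝ) ^ 4 ≤ a ^ (4 * x) := by
    have : (a ^ 2 * (v : ℝ)) ^ 4 ≤ (a ^ x) ^ 4 := by gcongr
    calc _ = (a ^ 2 * (v : ℝ)) ^ 4 := by ring
      _ ≤ _ := this
      _ = _ := by rw [← pow_mul, mul_comm]
  suffices hs : a ^ (y + L) ≤ a ^ 12 * (v : ℝ) ^ 4 by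
    have : a ^ (y + L) ≤ a ^ (4 * x + 4) := by
      calc _ ≤ _ := hs
        _ = a ^ 4 * (a ^ 8 * (v : ℝ) ^ 4) := by ring
        _ ≤ a ^ 4 * a ^ (4 * x) := by gcongr
        _ = _ := by ring
    have := (pow_le_pow_iff_right₀ (by linarith : 1 < a)).mp this
    omega
  rcases le_total (y + L) (4 * L) with hc | hc
  · -- large gap
    have k1 : a ^ 2 * (u * w : ℝ) ≤ a ^ y := by
      refine le_trans ?_ upy
      gcongr
      linarith
    have k2 : a ^ L ≤ a ^ 2 * v := by
      have hwp : 0 < (w : ℝ) := by linarith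
      have : a ^ L * (a ^ 2 * w) ≤ (a ^ 2 * v) * (a ^ 2 * w) := by
        calc a ^ L * (a ^ 2 * w) ≤ a ^ L * (a ^ 2 * (u * w)) := by
              gcongr; nlinarith
          _ ≤ a ^ L * a ^ y := by gcongr
          _ = a ^ (y + L) := by ring
          _ ≤ _ := lo'
          _ = _ := by ring
      exact le_of_mul_le_mul_right this (by positivity)
    calc a ^ (y + L) ≤ a ^ (4 * L) := pow_le_pow_right₀ (by linarith) hc
      _ = (a ^ L) ^ 4 := by rw [← pow_mul, mul_comm]
      _ ≤ (a ^ 2 * v) ^ 4 := by gcongr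
      _ = a ^ 8 * (v : ℝ) ^ 4 := by ring
      _ ≤ a ^ 12 * (v : ℝ) ^ 4 := by
        gcongr
        · linarith
        · norm_num
  · -- small gap
    obtain ⟨t, ht⟩ := (t_int a a3 L).1
    obtain ⟨s, hs⟩ := (s_int a a3 L).1
    have hP : (1 : ℝ) ≤ |(v : ℝ) ^ 3 - t * v ^ 2 * u + s * v * u ^ 2 - u ^ 3| := by
      have := Int.one_le_abs (P_ne u v t s hu huv)
      exact_mod_cast this
    have hqa : a ^ L * (a ^ 2 - a - 1) ^ L = 1 := by
      rw [← mul_pow, show a * (a ^ 2 - a - 1) = 1 by linear_combination a3, one_pow]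
    have hfac : (v : ℝ) ^ 3 - t * v ^ 2 * u + s * v * u ^ 2 - u ^ 3 =
        (v - a ^ L * u) * (v ^ 2 - pp a L * u * v + (a ^ 2 - a - 1) ^ L * u ^ 2) := by
      rw [← ht, ← hs]; linear_combination (u : ℝ) ^ 3 * hqa
    have hQ : |(v : ℝ) ^ 2 - pp a L * u * v + (a ^ 2 - a - 1) ^ L * u ^ 2| ≤ 4 * (v : ℝ) ^ 2 := by
      have pb := abs_le.mp (pp_bound a a1 a2 a3 L)
      have q0 : 0 ≤ (a ^ 2 - a - 1) ^ L := pow_nonneg qq0 _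
      have q1 : (a ^ 2 - a - 1) ^ L ≤ 1 := pow_le_one₀ qq0 qq1
      have huv0 : 0 ≤ (u : ℝ) * v := by nlinarith
      have huv1 : (u : ℝ) * v ≤ v ^ 2 := by nlinarith
      have huu : (u : ℝ) ^ 2 ≤ v ^ 2 := by nlinarith
      have m1 : (-2) * (u * v : ℝ) ≤ pp a L * (u * v) := mul_le_mul_of_nonneg_right pb.1 huv0
      have m2 : pp a L * (u * v) ≤ 2 * (u * v : ℝ) := mul_le_mul_of_nonneg_right pb.2 huv0
      have m3 : (a ^ 2 - a - 1) ^ L * (u : ℝ) ^ 2 ≤ 1 * u ^ 2 := by gcongr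
      have m4 : 0 ≤ (a ^ 2 - a - 1) ^ L * (u : ℝ) ^ 2 := by positivity
      rw [abs_le]
      constructor <;> nlinarith
    have hD := D_bound a a1 a2 a3 y L
    have aL : 1 ≤ a ^ L := one_le_pow₀ (by linarith)
    have hw : |(v : ℝ) - a ^ L * u| * w ≤ 4 * a ^ L := by
      have e : ((v : ℝ) - a ^ L * u) * w = ((T (y + L) : ℝ) - a ^ L * T y) + (a ^ L - 1) := by
        rw [← r2, ← r3]; ring
      rw [← abs_of_pos (by linarith : (0 : ℝ) < w), ← abs_mul, e]
      refine (abs_add_le _ _).trans ?_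
      rw [abs_of_nonneg (by linarith : 0 ≤ a ^ L - 1)]
      linarith
    have hw2 : (w : ℝ) ≤ 16 * v ^ 2 * a ^ L := by
      rw [hfac, abs_mul] at hP
      have hw0 : 0 ≤ (w : ℝ) := by linarith
      calc (w : ℝ) = 1 * w := by ring
        _ ≤ (|(v : ℝ) - a ^ L * u| * (4 * v ^ 2)) * w := by
          gcongr
          exact hP.trans (by gcongr)
        _ = (|(v : ℝ) - a ^ L * u| * w) * (4 * v ^ 2) := by ring
        _ ≤ (4 * a ^ L) * (4 * v ^ 2) := by gcongr
        _ = _ := by ring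
    have h16 : (16 : ℝ) ≤ a ^ 5 := by
      calc (16 : ℝ) ≤ 1.8 ^ 5 := by norm_num
        _ ≤ _ := by gcongr
    have hv0 : 0 ≤ (v : ℝ) := by linarith
    have hy1 : a ^ y ≤ a ^ 9 * (v : ℝ) ^ 3 := by
      have : a ^ y * a ^ L ≤ (a ^ 9 * (v : ℝ) ^ 3) * a ^ L := by
        calc a ^ y * a ^ L = a ^ (y + L) := by ring
          _ ≤ _ := lo'
          _ ≤ a ^ 4 * (v * (16 * v ^ 2 * a ^ L)) := by gcongr
          _ = 16 * (a ^ 4 * v ^ 3 * a ^ L) := by ring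
          _ ≤ a ^ 5 * (a ^ 4 * v ^ 3 * a ^ L) := by gcongr
          _ = _ := by ring
      exact le_of_mul_le_mul_right this (by positivity)
    have hcube : (a ^ (y + L)) ^ 3 ≤ (a ^ 12 * (v : ℝ) ^ 4) ^ 3 := by
      calc (a ^ (y + L)) ^ 3 = a ^ (3 * (y + L)) := by rw [← pow_mul, mul_comm]
        _ ≤ a ^ (4 * y) := pow_le_pow_right₀ (by linarith) (by omega)
        _ = (a ^ y) ^ 4 := by rw [← pow_mul, mul_comm]
        _ ≤ (a ^ 9 * (v : ℝ) ^ 3) ^ 4 := by gcongr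
        _ = _ := by ring
    exact le_of_pow_le_pow_left₀ (by norm_num) (by positivity) hcube
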